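/- Let G be a finite group acting transitively and faithfully on a finite set Ω and let α ∈ Ω. If |Ω|/2 < |Ω_{α,1}| + |Ω_{α,2}| < |Ω|, then Ω = Ω_{α,1} ∪ Ω_{α,2} ∪ Ω_{α,4}; in particular Ω_{α,i} = ∅ for every positive integer i with i ∉ {1,2,4}. -/

import Mathlib

open MulAction

section SuborbitLengths

variable {G Ω : Type*} [Group G] [MulAction G Ω]

theorem card_orbit_stabilizer_eq_relIndex (a b : Ω) :
    Nat.card (orbit (stabilizer G a) b) = (stabilizer G b).relIndex (stabilizer G a) := by
  have h : stabilizer (stabilizer G a) b = (stabilizer G b).subgroupOf (stabilizer G a) := by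
    ext g
    rfl
  rw [Subgroup.relIndex, ← h, index_stabilizer, Nat.card_coe_set_eq]

theorem relIndex_stabilizer_comm [Finite G] [IsPretransitive G Ω] (a b : Ω) :
    (stabilizer G a).relIndex (stabilizer G b) = (stabilizer G b).relIndex (stabilizer G a) := by
  have hcard : Nat.card (stabilizer G a) = Nat.card (stabilizer G b) := by
    obtain ⟨g, rfl⟩ := exists_smul_eq G a b
    exact Nat.card_congr (stabilizerEquivStabilizer (G := G) (g := g) rfl).toEquiv
  have key (H K : Subgroup G) : Nat.card (H ⊓ K : Subgroup G) * H.relIndex K = Nat.card K := by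
    rw [← Subgroup.inf_relIndex_right, ← Subgroup.relIndex_bot_left,
      Subgroup.relIndex_mul_relIndex _ _ _ bot_le inf_le_right, Subgroup.relIndex_bot_left]
  have h₁ := key (stabilizer G a) (stabilizer G b)
  have h₂ := key (stabilizer G b) (stabilizer G a)
  rw [inf_comm, hcard] at h₂
  exact Nat.eq_of_mul_eq_mul_left Nat.card_pos (h₁.trans h₂.symm)

theorem relIndex_stabilizer_smul (g : G) (a b : Ω) :
    (stabilizer G (g • a)).relIndex (stabilizer G (g • b)) =
      (stabilizer G a).relIndex (stabilizer G b) := by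
  rw [stabilizer_smul_eq_stabilizer_map_conj, stabilizer_smul_eq_stabilizer_map_conj]
  exact Subgroup.relIndex_map_map_of_injective _ _ (MulAut.conj g).injective

/-- If more than half of the points lie in suborbits of length at most `2`, then any two points
have a common neighbour in the corresponding graph. -/
theorem exists_relIndex_stabilizer_le_two [Finite Ω] [IsPretransitive G Ω] (a b : Ω)
    (h : Nat.card Ω < 2 * {c : Ω | (stabilizer G c).relIndex (stabilizer G a) ≤ 2}.ncard) :
    ∃ c : Ω, (stabilizer G c).relIndex (stabilizer G a) ≤ 2 ∧
      (stabilizer G c).relIndex (stabilizer G b) ≤ 2 := by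
  obtain ⟨g, rfl⟩ := exists_smul_eq G a b
  set s := {c : Ω | (stabilizer G c).relIndex (stabilizer G a) ≤ 2}
  set t := {c : Ω | (stabilizer G c).relIndex (stabilizer G (g • a)) ≤ 2}
  have hst : s.ncard ≤ t.ncard := by
    refine Set.ncard_le_ncard_of_injOn (g • ·) (fun c hc => ?_) (MulAction.injective g).injOn
    simpa [s, t, relIndex_stabilizer_smul] using hc
  have hcard := Set.ncard_union_add_ncard_inter s t
  have hunion : (s ∪ t).ncard ≤ Nat.card Ω := Set.ncard_le_card _
  obtain ⟨c, hs, ht⟩ := Set.nonempty_of_ncard_ne_zero (s := s ∩ t) (by omega)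
  exact ⟨c, hs, ht⟩

end SuborbitLengths

/-- Two successive steps of relative index at most `2` give relative index `1`, `2` or `4`. -/
theorem Subgroup.relIndex_eq_one_or_two_or_four {G : Type*} [Group G] [Finite G]
    {H K L : Subgroup G} (hHK : H.relIndex K ≤ 2) (hKL : K.relIndex L ≤ 2) :
    H.relIndex L = 1 ∨ H.relIndex L = 2 ∨ H.relIndex L = 4 := by
  have h₁ : H.relIndex (K ⊓ L) ≤ 2 :=
    (relIndex_le_of_le_right inf_le_left index_ne_zero_of_finite).trans hHK
  have h₁' : H.relIndex (K ⊓ L) ≠ 0 := index_ne_zero_of_finite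
  have h₂' : K.relIndex L ≠ 0 := index_ne_zero_of_finite
  have hdvd : H.relIndex L ∣ H.relIndex (K ⊓ L) * K.relIndex L := by
    rw [relIndex_inf_mul_relIndex]
    exact relIndex_dvd_of_le_left L inf_le_left
  have hfour : H.relIndex (K ⊓ L) * K.relIndex L ∣ 2 ^ 2 := by
    rw [pow_two]
    refine mul_dvd_mul ?_ ?_
    · interval_cases H.relIndex (K ⊓ L) <;> simp_all
    · interval_cases K.relIndex L <;> simp_all
  obtain ⟨k, hk, h⟩ := (Nat.dvd_prime_pow Nat.prime_two).1 (hdvd.trans hfour)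
  interval_cases k <;> simp_all

theorem stmt_5 {G Ω : Type*} [Group G] [Finite G] [Finite Ω] [MulAction G Ω]
    [IsPretransitive G Ω] [FaithfulSMul G Ω] (α : Ω)
    (h1 : (Nat.card Ω : ℚ) / 2 <
      ({δ : Ω | Nat.card (orbit (stabilizer G α) δ) = 1}.ncard : ℚ)
      + ({δ : Ω | Nat.card (orbit (stabilizer G α) δ) = 2}.ncard : ℚ))
    (h2 : ({δ : Ω | Nat.card (orbit (stabilizer G α) δ) = 1}.ncard : ℚ)
      + ({δ : Ω | Nat.card (orbit (stabilizer G α) δ) = 2}.ncard : ℚ)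
      < (Nat.card Ω : ℚ)) :
    (∀ δ : Ω, Nat.card (orbit (stabilizer G α) δ) = 1 ∨
      Nat.card (orbit (stabilizer G α) δ) = 2 ∨
      Nat.card (orbit (stabilizer G α) δ) = 4) ∧
    (∀ i : ℕ, 0 < i → i ∉ ({1, 2, 4} : Set ℕ) →
      {δ : Ω | Nat.card (orbit (stabilizer G α) δ) = i} = ∅) := by
  have hmem (δ : Ω) : Nat.card (orbit (stabilizer G α) δ) = 1 ∨
      Nat.card (orbit (stabilizer G α) δ) = 2 ∨
      Nat.card (orbit (stabilizer G α) δ) = 4 := by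
    simp only [card_orbit_stabilizer_eq_relIndex] at h1 ⊢
    have hdisj : Disjoint {δ : Ω | (stabilizer G δ).relIndex (stabilizer G α) = 1}
        {δ : Ω | (stabilizer G δ).relIndex (stabilizer G α) = 2} :=
      Set.disjoint_left.2 fun c (hc : _ = 1) (hc' : _ = 2) => by omega
    have hsub : {δ : Ω | (stabilizer G δ).relIndex (stabilizer G α) = 1} ∪
        {δ : Ω | (stabilizer G δ).relIndex (stabilizer G α) = 2} ⊆
        {δ : Ω | (stabilizer G δ).relIndex (stabilizer G α) ≤ 2} := by
      rintro c (hc | hc)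
      exacts [hc.le.trans one_le_two, hc.le]
    have hle := Set.ncard_le_ncard hsub
    rw [Set.ncard_union_eq hdisj] at hle
    have hhalf : Nat.card Ω <
        2 * {δ : Ω | (stabilizer G δ).relIndex (stabilizer G α) ≤ 2}.ncard := by
      have : (Nat.card Ω : ℚ) <
          2 * ({δ : Ω | (stabilizer G δ).relIndex (stabilizer G α) = 1}.ncard +
            {δ : Ω | (stabilizer G δ).relIndex (stabilizer G α) = 2}.ncard) := by linarith
      have : Nat.card Ω <
          2 * ({δ : Ω | (stabilizer G δ).relIndex (stabilizer G α) = 1}.ncard +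
            {δ : Ω | (stabilizer G δ).relIndex (stabilizer G α) = 2}.ncard) := by
        exact_mod_cast this
      omega
    obtain ⟨γ, hα, hδ⟩ := exists_relIndex_stabilizer_le_two α δ hhalf
    rw [relIndex_stabilizer_comm] at hδ
    exact Subgroup.relIndex_eq_one_or_two_or_four hδ hα
  refine ⟨hmem, fun i _ hi => Set.eq_empty_of_forall_notMem fun δ hδ => hi ?_⟩
  rw [← show Nat.card (orbit (stabilizer G α) δ) = i from hδ]
  simpa using hmem δ
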